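/- Let m,n ≥ 2, X = {1,...,m} × {1,...,n}, P the partition of X into blocks C_i = {i} × {1,...,n}, and S = E(X,P) the idempotent-generated submonoid of T(X,P). Then (a) every idempotent generating set of S contains an idempotent generating set of S of the minimal cardinality m·ρ_n + n!·(m choose 2), and (b) the number of idempotent generating sets of S of minimal cardinality equals σ_n^m · ∑_{k=0}^{(m choose 2)} w_{mk}·(2^{n!} − 2)^k, where σ_2 = 1, σ_n for n ≠ 2 is the number of strongly connected tournaments on n labelled vertices, and w_{mk} is the number of strongly connected, complete digraphs on vertex set {1,...,m} with exactly k double edges. -/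

import Mathlib

/-- `BP f` says that `f : X → X`, with `X = {1,…,m} × {1,…,n}`, preserves the partition of
`X` into the blocks `C_i = {i} × {1,…,n}`, i.e. `f ∈ T(X,P)`. -/
def BP {m n : ℕ} (f : Fin m × Fin n → Fin m × Fin n) : Prop :=
  ∀ i : Fin m, ∃ j : Fin m, ∀ x : Fin n, (f (i, x)).1 = j

/-- The number of strongly connected tournaments on `t` labelled vertices. -/
noncomputable def scTournaments (t : ℕ) : ℕ :=
  Nat.card {R : Fin t → Fin t → Prop //
    (∀ u, ¬ R u u) ∧ (∀ u v, u ≠ v → (R u v ↔ ¬ R v u)) ∧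
    ∀ u v, Relation.ReflTransGen R u v}

/-- `wdig t k`: the number of strongly connected, complete digraphs on `t` labelled
vertices with exactly `k` double edges. -/
noncomputable def wdig (t k : ℕ) : ℕ :=
  Nat.card {R : Fin t → Fin t → Prop //
    (∀ u, ¬ R u u) ∧ (∀ u v, u ≠ v → R u v ∨ R v u) ∧
    (∀ u v, Relation.ReflTransGen R u v) ∧
    {p : Fin t × Fin t | p.1 < p.2 ∧ R p.1 p.2 ∧ R p.2 p.1}.ncard = k}

theorem end_mul_apply {α : Type*} (f g : Function.End α) (a : α) : (f * g) a = f (g a) := rfl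

/-- The map sending `x` to `y` and fixing every other point. -/
def collapse {α : Type*} [DecidableEq α] (x y : α) : Function.End α := Function.update id x y

theorem collapse_apply {α : Type*} [DecidableEq α] (x y a : α) :
    collapse x y a = if a = x then y else a := by
  simp only [collapse, Function.update_apply, id]

theorem swap_comp_mem {α : Type*} [DecidableEq α] {M : Submonoid (Function.End α)}
    (hM : ∀ x y, x ≠ y → collapse x y ∈ M) {g : Function.End α} (hg : g ∈ M) {z : α}
    (hz : ∀ a, g a ≠ z) {x y : α} (hxy : x ≠ y) :
    (fun a => Equiv.swap x y (g a) : Function.End α) ∈ M := by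
  by_cases hxz : x = z
  · have : (fun a => Equiv.swap x y (g a) : Function.End α) = collapse y z * g := by
      funext a
      have := hz a
      simp only [end_mul_apply, collapse_apply, Equiv.swap_apply_def]
      grind
    rw [this]
    exact M.mul_mem (hM _ _ (by grind)) hg
  by_cases hyz : y = z
  · have : (fun a => Equiv.swap x y (g a) : Function.End α) = collapse x z * g := by
      funext a
      have := hz a
      simp only [end_mul_apply, collapse_apply, Equiv.swap_apply_def]
      grind
    rw [this]
    exact M.mul_mem (hM _ _ hxz) hg
  have : (fun a => Equiv.swap x y (g a) : Function.End α) =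
      collapse z y * (collapse y x * (collapse x z * g)) := by
    funext a
    have := hz a
    simp only [end_mul_apply, collapse_apply, Equiv.swap_apply_def]
    grind
  rw [this]
  exact M.mul_mem (hM _ _ (Ne.symm hyz)) (M.mul_mem (hM _ _ hxy.symm) (M.mul_mem (hM _ _ hxz) hg))

theorem perm_comp_mem {α : Type*} [DecidableEq α] [Finite α] {M : Submonoid (Function.End α)}
    (hM : ∀ x y, x ≠ y → collapse x y ∈ M) {g : Function.End α} (hg : g ∈ M) {z : α}
    (hz : ∀ a, g a ≠ z) (σ : Equiv.Perm α) :
    (fun a => σ (g a) : Function.End α) ∈ M := by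
  induction σ using Equiv.Perm.swap_induction_on with
  | one => exact hg
  | swap_mul f x y hxy ih =>
    exact swap_comp_mem (z := f z) hM ih (fun a h => hz a (f.injective h)) hxy

/-- A submonoid containing all idempotents of defect one contains all singular maps. -/
theorem mem_of_not_injective {α : Type*} [DecidableEq α] [Fintype α]
    {M : Submonoid (Function.End α)} (hM : ∀ x y, x ≠ y → collapse x y ∈ M)
    (f : Function.End α) (hf : ¬ Function.Injective f) : f ∈ M := by
  induction hk : Fintype.card α - (Finset.univ.image f).card using Nat.strong_induction_on
    generalizing f with
  | _ k ih =>
  have hs : ¬ Function.Surjective f := fun h => hf (Finite.injective_iff_surjective.2 h)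
  simp only [Function.Surjective, not_forall, not_exists] at hs
  obtain ⟨z, hz⟩ := hs
  simp only [Function.Injective, not_forall] at hf
  obtain ⟨x, y, hxy, hne⟩ := hf
  obtain ⟨g, hg⟩ : ∃ g : Function.End α, ∀ a, g a = if a = x then z else f a :=
    ⟨fun a => if a = x then z else f a, fun _ => rfl⟩
  have hfg : f = g * collapse x y := by
    funext a
    rw [end_mul_apply, collapse_apply, hg]
    grind
  by_cases hgi : Function.Injective g
  · have := perm_comp_mem hM (hM x y hne) (z := x)
      (fun a => by rw [collapse_apply]; grind)
      (Equiv.ofBijective g (Finite.injective_iff_bijective.1 hgi))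
    rw [hfg]
    exact this
  · rw [hfg]
    refine M.mul_mem (ih _ ?_ g hgi rfl) (hM x y hne)
    have hsub : insert z (Finset.univ.image f) ⊆ Finset.univ.image g := by
      intro w hw
      rcases Finset.mem_insert.1 hw with rfl | hw
      · exact Finset.mem_image.2 ⟨x, Finset.mem_univ _, by rw [hg, if_pos rfl]⟩
      obtain ⟨a, -, rfl⟩ := Finset.mem_image.1 hw
      by_cases hax : a = x
      · exact Finset.mem_image.2 ⟨y, Finset.mem_univ _, by rw [hg]; grind⟩
      · exact Finset.mem_image.2 ⟨a, Finset.mem_univ _, by rw [hg]; grind⟩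
    have hz' : z ∉ Finset.univ.image f := fun h => by
      obtain ⟨a, -, ha⟩ := Finset.mem_image.1 h
      exact hz a ha
    have h1 := Finset.card_le_card hsub
    rw [Finset.card_insert_of_notMem hz'] at h1
    have h2 := Finset.card_le_univ (Finset.univ.image g)
    omega

/-- `u` fixes everything outside the fibre of `β` over `b`, which it maps injectively into the
fibre over `d`. -/
def Moves {X I : Type*} (β : X → I) (b d : I) (u : X → X) : Prop :=
  (∀ x, β x ≠ b → u x = x) ∧ (∀ x, β x = b → β (u x) = d) ∧ Set.InjOn u {x | β x = b}

theorem Moves.injOn {X I : Type*} {β : X → I} {b d : I} {u : X → X} (h : Moves β b d u) :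
    Set.InjOn u {x | β x ≠ d} := by
  obtain ⟨h1, h2, h3⟩ := h
  intro x hx y hy hxy
  simp only [Set.mem_ofPred_eq] at hx hy
  by_cases hxb : β x = b <;> by_cases hyb : β y = b
  · exact h3 hxb hyb hxy
  · have := h2 x hxb
    rw [hxy, h1 y hyb] at this
    exact absurd this hy
  · have := h2 y hyb
    rw [← hxy, h1 x hxb] at this
    exact absurd this hx
  · rwa [h1 x hxb, h1 y hyb] at hxy

theorem Moves.apply_ne {X I : Type*} {β : X → I} {b d : I} {u : X → X} (h : Moves β b d u)
    (hbd : b ≠ d) (x : X) : β (u x) ≠ b := by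
  obtain ⟨h1, h2, -⟩ := h
  by_cases hxb : β x = b
  · rw [h2 x hxb]; exact hbd.symm
  · rwa [h1 x hxb]

theorem exists_shift {X I : Type*} {β : X → I} {M : Submonoid (Function.End X)} {i j : I}
    (h : Relation.ReflTransGen (fun b d => b ≠ d ∧ ∃ u ∈ M, Moves β b d u) i j) :
    ∃ s ∈ M, Set.InjOn s {x | β x ≠ j} ∧ Set.MapsTo s {x | β x ≠ j} {x | β x ≠ i} := by
  induction h using Relation.ReflTransGen.head_induction_on with
  | refl => exact ⟨1, M.one_mem, fun _ _ _ _ h => h, fun _ h => h⟩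
  | head h' _ ih =>
    obtain ⟨hne, u, hu, hmov⟩ := h'
    obtain ⟨s, hs, hinj, hmap⟩ := ih
    exact ⟨u * s, M.mul_mem hu hs, hmov.injOn.comp hinj hmap,
      fun x _ => hmov.apply_ne hne (s x)⟩

theorem exists_pow_apply_eq {X : Type*} [Finite X] (a : Function.End X) (A : Set X)
    (hinj : Set.InjOn a A) (hmap : Set.MapsTo a A A) :
    ∃ N, ∀ x ∈ A, (a ^ (N + 1)) x = x := by
  let σ : Equiv.Perm A := Equiv.ofBijective (hmap.restrict a A A)
    (Finite.injective_iff_bijective.1 (hmap.restrict_inj.2 hinj))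
  obtain ⟨N, hN, h⟩ := (isOfFinOrder_of_finite σ).exists_pow_eq_one
  obtain ⟨N, rfl⟩ := Nat.exists_eq_succ_of_ne_zero hN.ne'
  have key : ∀ k (x : A), ((σ ^ k) x : X) = (a ^ k) x := by
    intro k
    induction k with
    | zero => intro x; rfl
    | succ k ih =>
      intro x
      rw [pow_succ, pow_succ, Equiv.Perm.mul_apply, ih]
      rfl
  refine ⟨N, fun x hx => ?_⟩
  have := key (N + 1) ⟨x, hx⟩
  rw [h] at this
  exact this.symm

/-- An idempotent move can be reversed along a directed path of moves. -/
theorem reverse_mem {X I : Type*} [Finite X] [DecidableEq I] {β : X → I}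
    {M : Submonoid (Function.End X)} {i j : I} (hij : i ≠ j)
    (h : Relation.ReflTransGen (fun b d => b ≠ d ∧ ∃ u ∈ M, Moves β b d u) i j)
    {v : Function.End X} (hv : v ∈ M) (hmov : Moves β j i v) (p : X → X)
    (hp : ∀ x, β x = i → β (p x) = j ∧ v (p x) = x) :
    (fun x => if β x = i then p x else x : Function.End X) ∈ M := by
  obtain ⟨s, hs, hinj, hmap⟩ := exists_shift h
  have hav : ∀ x, β (v x) ≠ j := hmov.apply_ne hij.symm
  obtain ⟨N, hN⟩ := exists_pow_apply_eq (s * v) {x | β x ≠ i}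
    (hinj.comp hmov.injOn fun x _ => hav x) (fun x _ => hmap (hav x))
  suffices (fun x => if β x = i then p x else x : Function.End X) = (s * v) ^ (N + 1) from
    this ▸ M.pow_mem (M.mul_mem hs hv) (N + 1)
  funext x
  split_ifs with hx
  · obtain ⟨h1, h2⟩ := hp x hx
    rw [← hN (p x) (by simp only [Set.mem_ofPred_eq, h1]; exact hij.symm), pow_succ]
    simp only [end_mul_apply, h2]
    rw [hmov.1 x (by rw [hx]; exact hij)]
  · exact (hN x hx).symm

theorem exists_of_injOn_fiber {X I : Type*} [Finite X] {β : X → I} {N : ℕ}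
    (hβ : ∀ b, {x | β x = b}.ncard = N) {b d : I} {f : X → X} (hinj : Set.InjOn f {x | β x = b})
    (hmap : ∀ x, β x = b → β (f x) = d) (y : X) (hy : β y = d) : ∃ x, β x = b ∧ f x = y := by
  have : f '' {x | β x = b} = {x | β x = d} := by
    refine Set.eq_of_subset_of_ncard_le ?_ ?_ (Set.toFinite _)
    · rintro _ ⟨x, hx, rfl⟩; exact hmap x hx
    · rw [hinj.ncard_image, hβ, hβ]
  have hy' : y ∈ {x | β x = d} := hy
  rw [← this] at hy'
  exact hy'

theorem exists_of_injOn_compl_fiber {X I : Type*} [Finite X] {β : X → I} {N : ℕ}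
    (hβ : ∀ b, {x | β x = b}.ncard = N) {b d : I} {f : X → X} (hinj : Set.InjOn f {x | β x ≠ b})
    (hmap : ∀ x, β x ≠ b → β (f x) ≠ d) (y : X) (hy : β y ≠ d) : ∃ x, β x ≠ b ∧ f x = y := by
  have hc : ∀ b, {x | β x ≠ b}.ncard = Nat.card X - N := by
    intro b
    have := Set.ncard_add_ncard_compl {x | β x = b}
    rw [hβ] at this
    have h2 : {x | β x = b}ᶜ = {x | β x ≠ b} := rfl
    rw [h2] at this
    omega
  have : f '' {x | β x ≠ b} = {x | β x ≠ d} := by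
    refine Set.eq_of_subset_of_ncard_le ?_ ?_ (Set.toFinite _)
    · rintro _ ⟨x, hx, rfl⟩; exact hmap x hx
    · rw [hinj.ncard_image, hc, hc]
  have hy' : y ∈ {x | β x ≠ d} := hy
  rw [← this] at hy'
  exact hy'

/-- An idempotent that shifts a fibre after `h`, without losing injectivity off some fibre, is a
move. -/
theorem moves_of_mul {X I : Type*} [Finite X] {β : X → I} {N : ℕ}
    (hβ : ∀ b, {x | β x = b}.ncard = N) {u h : X → X} (huu : ∀ x, u (u x) = u x)
    {φ ψ : I → I} (hφ : ∀ x, β (u x) = φ (β x)) (hψ : ∀ x, β (h x) = ψ (β x)) {k : I}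
    (hinj : Set.InjOn (u ∘ h) {x | β x ≠ k}) {a : X} (ha : β a ≠ k)
    (hne : β (h a) ≠ β (u (h a))) : Moves β (β (h a)) (β (u (h a))) u := by
  have hφd : φ (β (u (h a))) = β (u (h a)) := by rw [← hφ, huu]
  have hmap : ∀ x, β x ≠ k → β (h x) ≠ β (u (h a)) := by
    intro x hx hxd
    obtain ⟨y, hy, hyx⟩ := exists_of_injOn_fiber (d := β (u (h a))) hβ
      (hinj.mono fun y (hy : β y = β a) => by rw [Set.mem_ofPred_eq, hy]; exact ha)
      (fun y hy => by simp only [Function.comp]; rw [hφ, hφ, hψ, hψ, hy]) ((u ∘ h) x)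
      (by simp only [Function.comp]; rw [hφ, hxd, hφd])
    have : y = x := hinj (by rw [Set.mem_ofPred_eq, hy]; exact ha) hx hyx
    subst this
    rw [hψ, hy, ← hψ] at hxd
    exact hne hxd
  have hu : Set.InjOn u {x | β x ≠ β (u (h a))} := by
    intro x hx y hy hxy
    obtain ⟨x', hx', rfl⟩ := exists_of_injOn_compl_fiber hβ
      (fun s hs t ht hst => hinj hs ht (congrArg u hst)) hmap x hx
    obtain ⟨y', hy', rfl⟩ := exists_of_injOn_compl_fiber hβ
      (fun s hs t ht hst => hinj hs ht (congrArg u hst)) hmap y hy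
    rw [hinj hx' hy' hxy]
  have hub : Set.InjOn u {x | β x = β (h a)} :=
    hu.mono fun x (hx : β x = _) => by rw [Set.mem_ofPred_eq, hx]; exact hne
  have hmb : ∀ x, β x = β (h a) → β (u x) = β (u (h a)) := fun x hx => by rw [hφ, hx, ← hφ]
  refine ⟨fun x hx => ?_, hmb, hub⟩
  by_cases hxd : β x = β (u (h a))
  · obtain ⟨y, -, rfl⟩ := exists_of_injOn_fiber hβ hub hmb x hxd
    exact huu y
  by_cases hud : β (u x) = β (u (h a))
  · obtain ⟨y, hy, hyx⟩ := exists_of_injOn_fiber hβ hub hmb (u x) hud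
    have : y = x := hu (by rw [Set.mem_ofPred_eq, hy]; exact hne) hxd hyx
    exact absurd (this ▸ hy) hx
  · exact hu hud hxd (huu x)

theorem reachable_of_mem_closure {X I : Type*} [Finite X] {β : X → I} {N : ℕ}
    (hβ : ∀ b, {x | β x = b}.ncard = N) {U : Set (Function.End X)} (hU : ∀ u ∈ U, u * u = u)
    (hUβ : ∀ u ∈ U, ∃ φ : I → I, ∀ x, β (u x) = φ (β x)) {i j : I} (hij : i ≠ j)
    {h : Function.End X} (hh : h ∈ Submonoid.closure U)
    (hi : Set.InjOn h {x | β x ≠ i}) (hj : Set.InjOn h {x | β x ≠ j}) (a : X) :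
    Relation.ReflTransGen (fun b d => b ≠ d ∧ ∃ u ∈ U, Moves β b d u) (β a) (β (h a)) := by
  have hpres : ∀ h ∈ Submonoid.closure U, ∃ φ : I → I, ∀ x, β (h x) = φ (β x) := by
    intro h hh
    induction hh using Submonoid.closure_induction with
    | mem u hu => exact hUβ u hu
    | one => exact ⟨id, fun _ => rfl⟩
    | mul f g _ _ hf hg =>
      obtain ⟨φ, hφ⟩ := hf
      obtain ⟨ψ, hψ⟩ := hg
      exact ⟨φ ∘ ψ, fun x => by rw [end_mul_apply, hφ, hψ]; rfl⟩
  induction hh using Submonoid.closure_induction_left with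
  | one => exact .refl
  | mul_left u hu h hh ih =>
    have step := ih (fun s hs t ht hst => hi hs ht (congrArg u hst))
      (fun s hs t ht hst => hj hs ht (congrArg u hst))
    by_cases hne : β (h a) = β (u (h a))
    · rw [end_mul_apply, ← hne]
      exact step
    · refine step.tail ⟨hne, u, hu, ?_⟩
      obtain ⟨φ, hφ⟩ := hUβ u hu
      obtain ⟨ψ, hψ⟩ := hpres h hh
      by_cases hai : β a = i
      · exact moves_of_mul hβ (fun x => congrFun (hU u hu) x) hφ hψ hj (hai ▸ hij) hne
      · exact moves_of_mul hβ (fun x => congrFun (hU u hu) x) hφ hψ hi hai hne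

theorem exists_eq_mul_of_mem_closure {M : Type*} [Monoid M] {U : Set M} {g : M}
    (hg : g ∈ Submonoid.closure U) (h1 : g ≠ 1) : ∃ u ∈ U, u ≠ 1 ∧ ∃ g', g = g' * u := by
  induction hg using Submonoid.closure_induction_right with
  | one => exact absurd rfl h1
  | mul_right x _ y hy ih =>
    by_cases hy1 : y = 1
    · subst hy1
      simpa using ih (by simpa using h1)
    · exact ⟨y, hy, hy1, x, rfl⟩

/-- The map sending block `i` onto block `j` via the permutation `π` and fixing every other point. -/
def slide {m n : ℕ} (i j : Fin m) (π : Equiv.Perm (Fin n)) : Function.End (Fin m × Fin n) :=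
  fun a => if a.1 = i then (j, π a.2) else a

theorem slide_apply {m n : ℕ} (i j : Fin m) (π : Equiv.Perm (Fin n)) (a : Fin m × Fin n) :
    slide i j π a = if a.1 = i then (j, π a.2) else a := rfl

theorem collapse_mul_self {α : Type*} [DecidableEq α] (x y : α) :
    collapse x y * collapse x y = collapse x y := by
  funext a
  simp only [end_mul_apply, collapse_apply]
  grind

theorem slide_mul_self {m n : ℕ} {i j : Fin m} (hij : i ≠ j) (π : Equiv.Perm (Fin n)) :
    slide i j π * slide i j π = slide i j π := by
  funext a
  simp only [end_mul_apply, slide_apply]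
  split_ifs with h1 h2
  · exact absurd h2 hij.symm
  · rfl
  · rfl

theorem bp_collapse {m n : ℕ} (i : Fin m) (x y : Fin n) : BP (collapse (i, x) (i, y)) := by
  refine fun k => ⟨k, fun z => ?_⟩
  rw [collapse_apply]
  split_ifs with h
  · exact (congrArg Prod.fst h).symm
  · rfl

theorem bp_slide {m n : ℕ} (i j : Fin m) (π : Equiv.Perm (Fin n)) : BP (slide i j π) := by
  refine fun k => ⟨if k = i then j else k, fun z => ?_⟩
  rw [slide_apply]
  dsimp only
  split_ifs <;> rfl

theorem bp_iff {m n : ℕ} {f : Fin m × Fin n → Fin m × Fin n} :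
    BP f ↔ ∃ φ : Fin m → Fin m, ∀ a, (f a).1 = φ a.1 := by
  refine ⟨fun h => ?_, fun ⟨φ, h⟩ i => ⟨φ i, fun x => h (i, x)⟩⟩
  choose φ hφ using h
  exact ⟨φ, fun a => hφ a.1 a.2⟩

theorem bp_of_mem_closure {m n : ℕ} {U : Set (Function.End (Fin m × Fin n))}
    (hU : ∀ f ∈ U, BP f) {f : Function.End (Fin m × Fin n)} (hf : f ∈ Submonoid.closure U) :
    BP f := by
  induction hf using Submonoid.closure_induction with
  | mem u hu => exact hU u hu
  | one => exact fun i => ⟨i, fun _ => rfl⟩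
  | mul f g _ _ hf hg =>
    obtain ⟨φ, hφ⟩ := bp_iff.1 hf
    obtain ⟨ψ, hψ⟩ := bp_iff.1 hg
    exact bp_iff.2 ⟨φ ∘ ψ, fun x => by rw [end_mul_apply, hφ, hψ]; rfl⟩

/-- The embedding of the full transformation monoid acting on block `i`. -/
def onBlock {m n : ℕ} (i : Fin m) : Function.End (Fin n) →* Function.End (Fin m × Fin n) where
  toFun f := fun a => if a.1 = i then (i, f a.2) else a
  map_one' := by
    funext a
    show (if a.1 = i then (i, a.2) else a) = a
    split_ifs with h
    · rw [← h]
    · rfl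
  map_mul' f g := by
    funext a
    show (if a.1 = i then (i, f (g a.2)) else a) =
      if (if a.1 = i then (i, g a.2) else a).1 = i then
        (i, f (if a.1 = i then (i, g a.2) else a).2) else (if a.1 = i then (i, g a.2) else a)
    by_cases h : a.1 = i <;> simp [h]

theorem onBlock_apply {m n : ℕ} (i : Fin m) (f : Function.End (Fin n)) (a : Fin m × Fin n) :
    onBlock i f a = if a.1 = i then (i, f a.2) else a := rfl

theorem onBlock_collapse {m n : ℕ} (i : Fin m) (x y : Fin n) :
    onBlock i (collapse x y) = collapse (i, x) (i, y) := by
  funext ⟨k, z⟩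
  simp only [onBlock_apply, collapse_apply, Prod.mk.injEq]
  grind

theorem onBlock_mem {m n : ℕ} {M : Submonoid (Function.End (Fin m × Fin n))}
    (hA : ∀ i x y, x ≠ y → collapse (i, x) (i, y) ∈ M) (i : Fin m) (f : Function.End (Fin n))
    (hf : f = 1 ∨ ¬ Function.Injective f) : onBlock i f ∈ M := by
  rcases hf with rfl | hf
  · rw [map_one]; exact M.one_mem
  · exact mem_of_not_injective (M := M.comap (onBlock i))
      (fun x y hxy => by rw [Submonoid.mem_comap, onBlock_collapse]; exact hA i x y hxy) f hf

theorem exists_blockwise_mem {m n : ℕ} {M : Submonoid (Function.End (Fin m × Fin n))}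
    (hA : ∀ i x y, x ≠ y → collapse (i, x) (i, y) ∈ M) (h : Fin m → Function.End (Fin n))
    (hh : ∀ i, h i = 1 ∨ ¬ Function.Injective (h i)) :
    ∃ g ∈ M, ∀ k z, g (k, z) = (k, h k z) := by
  have key : ∀ s : Finset (Fin m),
      ∃ g ∈ M, ∀ k z, g (k, z) = if k ∈ s then (k, h k z) else (k, z) := by
    intro s
    induction s using Finset.induction_on with
    | empty => exact ⟨1, M.one_mem, fun k z => by simp [Function.End.one_def]⟩
    | insert i s his ih =>
      obtain ⟨g, hg, hgs⟩ := ih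
      refine ⟨_, M.mul_mem (onBlock_mem hA i (h i) (hh i)) hg, fun k z => ?_⟩
      rw [end_mul_apply, onBlock_apply, hgs]
      by_cases hk : k = i
      · subst hk; simp [his]
      · by_cases hks : k ∈ s <;> simp [hk, hks]
  simpa using key Finset.univ

theorem exists_slides_mem {m n : ℕ} {M : Submonoid (Function.End (Fin m × Fin n))}
    (hB : ∀ i j π, i ≠ j → slide i j π ∈ M) {φ : Fin m → Fin m} (hφ : ∀ i, φ (φ i) = φ i)
    (π : Fin m → Equiv.Perm (Fin n)) :
    ∃ g ∈ M, ∀ k z, g (k, z) = if φ k = k then (k, z) else (φ k, π k z) := by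
  have key : ∀ s : Finset (Fin m), (∀ i ∈ s, φ i ≠ i) →
      ∃ g ∈ M, ∀ k z, g (k, z) = if k ∈ s then (φ k, π k z) else (k, z) := by
    intro s
    induction s using Finset.induction_on with
    | empty => exact fun _ => ⟨1, M.one_mem, fun k z => by simp [Function.End.one_def]⟩
    | insert i s his ih =>
      intro hs
      have hi := hs i (Finset.mem_insert_self i s)
      obtain ⟨g, hg, hgs⟩ := ih fun k hk => hs k (Finset.mem_insert_of_mem hk)
      refine ⟨_, M.mul_mem (hB i (φ i) (π i) hi.symm) hg, fun k z => ?_⟩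
      rw [end_mul_apply, slide_apply, hgs]
      by_cases hk : k = i
      · subst hk; simp [his]
      · by_cases hks : k ∈ s
        · have : φ k ≠ i := fun h => hi (by rw [← h, hφ])
          simp [hks, this]
        · simp [hk, hks]
  obtain ⟨g, hg, hgs⟩ := key (Finset.univ.filter fun i => φ i ≠ i) (by simp)
  refine ⟨g, hg, fun k z => ?_⟩
  rw [hgs]
  by_cases h : φ k = k <;> simp [h]

theorem idempotent_mem {m n : ℕ} {M : Submonoid (Function.End (Fin m × Fin n))}
    (hA : ∀ i x y, x ≠ y → collapse (i, x) (i, y) ∈ M)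
    (hB : ∀ i j π, i ≠ j → slide i j π ∈ M) {f : Function.End (Fin m × Fin n)} (hf : BP f)
    (hff : f * f = f) : f ∈ M := by
  classical
  obtain ⟨φ, hφ⟩ := bp_iff.1 hf
  have hff' : ∀ a, f (f a) = f a := fun a => congrFun hff a
  by_cases hn : IsEmpty (Fin n)
  · have : f = 1 := by funext a; exact hn.elim a.2
    rw [this]; exact M.one_mem
  rw [not_isEmpty_iff] at hn
  have hφφ : ∀ i, φ (φ i) = φ i := fun i => by
    have x : Fin n := Classical.arbitrary _
    have := hφ (f (i, x))
    rwa [hff', hφ, eq_comm] at this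
  let F : Fin m → Function.End (Fin n) := fun i x => (f (i, x)).2
  have hF : ∀ i x, f (i, x) = (φ i, F i x) := fun i x => Prod.ext (hφ _) rfl
  let π : Fin m → Equiv.Perm (Fin n) := fun i =>
    if h : Function.Bijective (F i) then Equiv.ofBijective (F i) h else 1
  have hπ : ∀ i, (h : Function.Bijective (F i)) → ∀ x, π i x = F i x := fun i h x => by
    simp only [π, dif_pos h]; rfl
  have hπ' : ∀ i, ¬ Function.Bijective (F i) → π i = 1 := fun i h => by
    simp only [π, dif_neg h]
  let h1 : Fin m → Function.End (Fin n) := fun i =>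
    if φ i = i ∨ Function.Bijective (F i) then 1 else F i
  let h2 : Fin m → Function.End (Fin n) := fun i => if φ i = i then F i else 1
  obtain ⟨g1, m1, hg1⟩ := exists_blockwise_mem hA h1 (fun i => by
    simp only [h1]
    split_ifs with h
    · exact .inl rfl
    · exact .inr fun hi => h (.inr (Finite.injective_iff_bijective.1 hi)))
  obtain ⟨g2, m2, hg2⟩ := exists_blockwise_mem hA h2 (fun i => by
    simp only [h2]
    split_ifs with h
    · by_cases hi : Function.Injective (F i)
      · left
        funext x
        have := hff' (i, x)
        rw [hF i x, h, hF i (F i x)] at this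
        have : F i (F i x) = F i x := (Prod.ext_iff.1 this).2
        replace this := hi this
        exact this
      · exact .inr hi
    · exact .inl rfl)
  obtain ⟨g, mg, hg⟩ := exists_slides_mem hB hφφ π
  suffices f = g2 * (g * g1) from this ▸ M.mul_mem m2 (M.mul_mem mg m1)
  funext ⟨i, x⟩
  have hx := hff' (i, x)
  rw [hF i x, hF (φ i), hφφ] at hx
  rw [end_mul_apply, end_mul_apply, hF, hg1, hg]
  by_cases h : φ i = i
  · rw [if_pos h, hg2]
    simp only [h1, h2, h, true_or, if_true]
    rfl
  · rw [if_neg h, hg2]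
    by_cases hb : Function.Bijective (F i)
    · simp only [h1, h2, h, hb, hφφ, or_true, if_true]
      rw [Function.End.one_def, id, hπ i hb]
      exact hx.symm
    · simp only [h1, h2, h, hb, hφφ, or_false, if_true, if_false, hπ' i hb]
      exact hx.symm

theorem exists_collapse_of_mem_closure {α : Type*} [DecidableEq α] {U : Set (Function.End α)}
    (hU : ∀ u ∈ U, u * u = u) {x y : α} (hxy : x ≠ y)
    (h : collapse x y ∈ Submonoid.closure U) : collapse x y ∈ U ∨ collapse y x ∈ U := by
  obtain ⟨u, hu, hu1, g', hg⟩ := exists_eq_mul_of_mem_closure h (fun h1 => by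
    have := congrFun h1 x
    rw [collapse_apply, if_pos rfl] at this
    exact hxy this.symm)
  have huu : ∀ a, u (u a) = u a := fun a => congrFun (hU u hu) a
  have hmoved : ∀ a, u a = a ∨ (a = x ∧ u a = y) ∨ (a = y ∧ u a = x) := by
    intro a
    have : collapse x y (u a) = collapse x y a := by
      rw [hg, end_mul_apply, end_mul_apply, huu]
    simp only [collapse_apply] at this
    grind
  have hex : ∃ a, u a ≠ a := by
    by_contra! hall
    exact hu1 (funext hall)
  obtain ⟨a, ha⟩ := hex
  have hcases : (u x = y ∧ u y = y) ∨ (u y = x ∧ u x = x) := by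
    rcases hmoved a with h | ⟨rfl, h⟩ | ⟨rfl, h⟩
    · exact absurd h ha
    · have := huu a; grind
    · have := huu a; grind
  rcases hcases with ⟨h1, h2⟩ | ⟨h1, h2⟩
  · left
    convert hu
    funext b
    rw [collapse_apply]
    have := hmoved b
    grind
  · right
    convert hu
    funext b
    rw [collapse_apply]
    have := hmoved b
    grind

theorem exists_slide_of_mem_closure {m n : ℕ} {U : Set (Function.End (Fin m × Fin n))}
    (hU : ∀ u ∈ U, u * u = u) (hUB : ∀ u ∈ U, BP u) {i j : Fin m} (hij : i ≠ j)
    (π : Equiv.Perm (Fin n)) [NeZero n]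
    (h : slide i j π ∈ Submonoid.closure U) : slide i j π ∈ U ∨ slide j i π⁻¹ ∈ U := by
  obtain ⟨u, hu, hu1, g', hg⟩ := exists_eq_mul_of_mem_closure h (fun h1 => by
    have := congrArg Prod.fst (congrFun h1 (i, 0))
    rw [slide_apply, if_pos rfl] at this
    exact hij this.symm)
  have huu : ∀ a, u (u a) = u a := fun a => congrFun (hU u hu) a
  obtain ⟨φ, hφ⟩ := bp_iff.1 (hUB u hu)
  have hmoved : ∀ a, u a = a ∨ (a.1 = i ∧ u a = (j, π a.2)) ∨ (a.1 = j ∧ u a = (i, π⁻¹ a.2)) := by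
    intro a
    have : slide i j π (u a) = slide i j π a := by
      rw [hg, end_mul_apply, end_mul_apply, huu]
    simp only [slide_apply] at this
    split_ifs at this with h1 h2 h2
    · left
      simp only [Prod.mk.injEq, true_and, EmbeddingLike.apply_eq_iff_eq] at this
      exact Prod.ext (h1.trans h2.symm) this
    · right; right
      have h3 : π (u a).2 = a.2 := congrArg Prod.snd this
      exact ⟨(congrArg Prod.fst this).symm, Prod.ext h1 (by rw [← h3]; simp)⟩
    · exact .inr (.inl ⟨h2, this⟩)
    · exact .inl this
  have hex : ∃ a, u a ≠ a := by
    by_contra! hall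
    exact hu1 (funext hall)
  obtain ⟨a, ha⟩ := hex
  rcases hmoved a with h | ⟨h1, h2⟩ | ⟨h1, h2⟩
  · exact absurd h ha
  · have hi : φ i = j := by rw [← h1, ← hφ, h2]
    have hj : φ j = j := by rw [← hi, ← h1, ← hφ, ← hφ, huu]
    left
    convert hu
    funext b
    rw [slide_apply]
    have := hmoved b
    have := hφ b
    grind
  · have hi : φ j = i := by rw [← h1, ← hφ, h2]
    have hj : φ i = i := by rw [← hi, ← h1, ← hφ, ← hφ, huu]
    right
    convert hu
    funext b
    rw [slide_apply]
    have := hmoved b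
    have := hφ b
    grind

theorem Moves.injOn_source {X I : Type*} {β : X → I} {b d : I} {u : X → X} (h : Moves β b d u) :
    Set.InjOn u {x | β x ≠ b} := fun x hx y hy hxy => by
  rwa [h.1 x hx, h.1 y hy] at hxy

theorem moves_collapse {α : Type*} [DecidableEq α] (x y : α) : Moves id x y (collapse x y) := by
  refine ⟨fun z hz => ?_, fun z hz => ?_, fun z hz w hw _ => ?_⟩
  · exact (collapse_apply x y z).trans (if_neg hz)
  · exact (collapse_apply x y z).trans (if_pos hz)
  · exact Eq.trans hz (Eq.symm hw)

theorem moves_slide {m n : ℕ} (i j : Fin m) (π : Equiv.Perm (Fin n)) :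
    Moves Prod.fst i j (slide i j π) := by
  refine ⟨fun z hz => ?_, fun z hz => ?_, fun z hz w hw h => ?_⟩
  · rw [slide_apply, if_neg hz]
  · rw [slide_apply, if_pos hz]
  · rw [slide_apply, slide_apply, if_pos (id hz : z.1 = i),
      if_pos (id hw : w.1 = i)] at h
    exact Prod.ext (Eq.trans hz (Eq.symm hw)) (π.injective (Prod.ext_iff.1 h).2)

theorem exists_eq_slide {m n : ℕ} {i j : Fin m} {u : Function.End (Fin m × Fin n)}
    (h : Moves Prod.fst i j u) : ∃ π, u = slide i j π := by
  obtain ⟨h1, h2, h3⟩ := h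
  have hinj : Function.Injective fun x => (u (i, x)).2 := fun x y hxy => by
    have : u (i, x) = u (i, y) := Prod.ext ((h2 _ rfl).trans (h2 _ rfl).symm) hxy
    exact (Prod.ext_iff.1 (h3 rfl rfl this)).2
  refine ⟨Equiv.ofBijective _ (Finite.injective_iff_bijective.1 hinj), ?_⟩
  funext ⟨k, x⟩
  rw [slide_apply]
  by_cases hk : k = i
  · subst hk
    rw [if_pos rfl]
    exact Prod.ext (h2 _ rfl) rfl
  · rw [if_neg hk, h1 _ hk]

theorem eq_collapse {α : Type*} [DecidableEq α] {x y : α} {u : Function.End α}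
    (h : Moves id x y u) : u = collapse x y := by
  funext a
  rw [collapse_apply]
  split_ifs with ha
  · exact h.2.1 a ha
  · exact h.1 a ha

theorem fst_eq_of_bp_collapse {m n : ℕ} (hn : 2 ≤ n) {a b : Fin m × Fin n}
    (h : BP (collapse a b)) : a.1 = b.1 := by
  have : Nontrivial (Fin n) := Fin.nontrivial_iff_two_le.2 hn
  obtain ⟨z, hz⟩ := exists_ne a.2
  obtain ⟨φ, hφ⟩ := bp_iff.1 h
  have h1 := hφ a
  have h2 := hφ (a.1, z)
  rw [collapse_apply, if_pos rfl] at h1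
  rw [collapse_apply, if_neg fun h => hz (Prod.ext_iff.1 h).2] at h2
  exact h2.trans h1.symm

/-- The combinatorial conditions under which a set of idempotents generates `E(X,P)`. -/
structure Generates {m n : ℕ} (U : Set (Function.End (Fin m × Fin n))) : Prop where
  bp : ∀ f ∈ U, BP f
  collapse_or : ∀ i x y, x ≠ y → collapse (i, x) (i, y) ∈ U ∨ collapse (i, y) (i, x) ∈ U
  collapse_reachable : ∀ i x y,
    Relation.ReflTransGen (fun x y => x ≠ y ∧ collapse (i, x) (i, y) ∈ U) x y
  slide_or : ∀ i j π, i ≠ j → slide i j π ∈ U ∨ slide j i π⁻¹ ∈ U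
  slide_reachable : ∀ i j,
    Relation.ReflTransGen (fun i j => i ≠ j ∧ ∃ π, slide i j π ∈ U) i j

theorem Generates.collapse_mem {m n : ℕ} {U : Set (Function.End (Fin m × Fin n))}
    (h : Generates U) (i : Fin m) {x y : Fin n} (hxy : x ≠ y) :
    collapse (i, x) (i, y) ∈ Submonoid.closure U := by
  rcases h.collapse_or i x y hxy with h1 | h1
  · exact Submonoid.subset_closure h1
  have hne : (i, x) ≠ (i, y) := fun h => hxy (Prod.ext_iff.1 h).2
  have hpath : Relation.ReflTransGen
      (fun b d => b ≠ d ∧ ∃ u ∈ Submonoid.closure U, Moves id b d u) (i, x) (i, y) := by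
    refine (h.collapse_reachable i x y).lift (fun x => (i, x)) fun a b hab => ?_
    exact ⟨fun h => hab.1 (Prod.ext_iff.1 h).2, _, Submonoid.subset_closure hab.2,
      moves_collapse _ _⟩
  have := reverse_mem hne hpath (Submonoid.subset_closure h1) (moves_collapse _ _)
    (fun _ => (i, y)) (fun z hz => ⟨rfl, by rw [collapse_apply, if_pos rfl]; exact Eq.symm hz⟩)
  refine Set.mem_of_eq_of_mem ?_ this
  funext z
  rw [collapse_apply]
  rfl

theorem Generates.slide_mem {m n : ℕ} {U : Set (Function.End (Fin m × Fin n))}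
    (h : Generates U) {i j : Fin m} (hij : i ≠ j) (π : Equiv.Perm (Fin n)) :
    slide i j π ∈ Submonoid.closure U := by
  rcases h.slide_or i j π hij with h1 | h1
  · exact Submonoid.subset_closure h1
  have hpath : Relation.ReflTransGen
      (fun b d => b ≠ d ∧ ∃ u ∈ Submonoid.closure U, Moves Prod.fst b d u) i j := by
    refine Relation.ReflTransGen.mono ?_ _ _ (h.slide_reachable i j)
    rintro a b ⟨hab, π, hπ⟩
    exact ⟨hab, _, Submonoid.subset_closure hπ, moves_slide _ _ _⟩
  exact reverse_mem hij hpath (Submonoid.subset_closure h1) (moves_slide _ _ _)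
    (fun a => (j, π a.2)) (fun z hz => ⟨rfl, by
      rw [slide_apply, if_pos rfl]; exact Prod.ext (Eq.symm hz) (by simp)⟩)

theorem closure_eq_iff {m n : ℕ} (hn : 2 ≤ n) {U : Set (Function.End (Fin m × Fin n))}
    (hU : ∀ f ∈ U, f * f = f) :
    Submonoid.closure U
        = Submonoid.closure {f : Function.End (Fin m × Fin n) | BP f ∧ f * f = f} ↔
      Generates U := by
  constructor
  · intro h
    have hbp : ∀ f ∈ U, BP f := fun f hf =>
      bp_of_mem_closure (fun g hg => hg.1) (h ▸ Submonoid.subset_closure hf)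
    have hcol : ∀ i x y, collapse (i, x) (i, y) ∈ Submonoid.closure U := fun i x y => by
      rw [h]
      exact Submonoid.subset_closure ⟨bp_collapse i x y, collapse_mul_self _ _⟩
    have hsl : ∀ i j π, i ≠ j → slide i j π ∈ Submonoid.closure U := fun i j π hij => by
      rw [h]
      exact Submonoid.subset_closure ⟨bp_slide i j π, slide_mul_self hij π⟩
    have : NeZero n := ⟨by omega⟩
    refine ⟨hbp, fun i x y hxy => exists_collapse_of_mem_closure hU
      (fun h => hxy (Prod.ext_iff.1 h).2) (hcol i x y), fun i x y => ?_, fun i j π hij =>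
      exists_slide_of_mem_closure hU hbp hij π (hsl i j π hij), fun i j => ?_⟩
    · by_cases hxy : x = y
      · rw [hxy]
      have hreach := reachable_of_mem_closure (β := (id : Fin m × Fin n → Fin m × Fin n)) (N := 1)
        (fun b => Set.ncard_singleton b) hU (fun u _ => ⟨u, fun _ => rfl⟩)
        (fun h => hxy (Prod.ext_iff.1 h).2) (hcol i x y) (moves_collapse _ _).injOn_source
        (moves_collapse _ _).injOn (i, x)
      rw [collapse_apply, if_pos rfl] at hreach
      have key : ∀ q : Fin m × Fin n, Relation.ReflTransGen
          (fun b d => b ≠ d ∧ ∃ u ∈ U, Moves id b d u) (i, x) q → q.1 = i ∧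
          Relation.ReflTransGen (fun x y => x ≠ y ∧ collapse (i, x) (i, y) ∈ U) x q.2 := by
        intro q hq
        induction hq with
        | refl => exact ⟨rfl, .refl⟩
        | tail _ hst ih =>
          obtain ⟨hne, u, hu, hmov⟩ := hst
          obtain ⟨h1, h2⟩ := ih
          rw [eq_collapse hmov] at hu
          have h3 := fst_eq_of_bp_collapse hn (hbp _ hu)
          refine ⟨h3 ▸ h1, h2.tail ⟨fun h => hne (Prod.ext h3 h), ?_⟩⟩
          convert hu
          · exact h1.symm
          · exact h1.symm.trans h3
      exact (key _ hreach).2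
    · by_cases hij : i = j
      · rw [hij]
      have hfib : ∀ b : Fin m, {x : Fin m × Fin n | x.1 = b}.ncard = n := fun b => by
        have : {x : Fin m × Fin n | x.1 = b} = Set.range fun z : Fin n => (b, z) := by
          ext ⟨k, z⟩
          simp [eq_comm]
        rw [this, Set.ncard_range_of_injective fun s t h => (Prod.ext_iff.1 h).2, Nat.card_fin]
      have hreach := reachable_of_mem_closure hfib hU (fun u hu => bp_iff.1 (hbp u hu)) hij
        (hsl i j 1 hij) (moves_slide _ _ _).injOn_source (moves_slide _ _ _).injOn (i, 0)
      rw [slide_apply, if_pos rfl] at hreach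
      refine Relation.ReflTransGen.mono ?_ _ _ hreach
      rintro a b ⟨hne, u, hu, hmov⟩
      obtain ⟨π, rfl⟩ := exists_eq_slide hmov
      exact ⟨hne, π, hu⟩
  · intro h
    refine le_antisymm (Submonoid.closure_mono fun f hf => ⟨h.bp f hf, hU f hf⟩) ?_
    rw [Submonoid.closure_le]
    rintro f ⟨hf, hff⟩
    exact idempotent_mem (fun i x y hxy => h.collapse_mem i hxy)
      (fun i j π hij => h.slide_mem hij π) hf hff

theorem reachable_remove {V : Type*} {R : V → V → Prop} {u v : V}
    (hsc : ∀ a b, Relation.ReflTransGen R a b)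
    (h : Relation.ReflTransGen (fun a b => R a b ∧ ¬ (a = u ∧ b = v)) u v) (a b : V) :
    Relation.ReflTransGen (fun a b => R a b ∧ ¬ (a = u ∧ b = v)) a b := by
  induction hsc a b with
  | refl => exact .refl
  | @tail c d _ hcd ih =>
    by_cases hc : c = u ∧ d = v
    · obtain ⟨rfl, rfl⟩ := hc
      exact ih.trans h
    · exact ih.tail ⟨hcd, hc⟩

/-- In a strongly connected complete digraph with at least three vertices, one of the two edges of
a double edge can be removed without losing strong connectivity. -/
theorem remove_edge_or {V : Type*} {R : V → V → Prop}
    (hc : ∀ a b, a ≠ b → R a b ∨ R b a) (hsc : ∀ a b, Relation.ReflTransGen R a b) {u v w : V}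
    (hwu : w ≠ u) (hwv : w ≠ v) :
    (∀ a b, Relation.ReflTransGen (fun a b => R a b ∧ ¬ (a = u ∧ b = v)) a b) ∨
      ∀ a b, Relation.ReflTransGen (fun a b => R a b ∧ ¬ (a = v ∧ b = u)) a b := by
  by_contra hcon
  rw [not_or] at hcon
  obtain ⟨h1, h2⟩ := hcon
  have hA : ¬ Relation.ReflTransGen (fun a b => R a b ∧ ¬ (a = u ∧ b = v)) u v :=
    fun h => h1 (reachable_remove hsc h)
  have hB : ¬ Relation.ReflTransGen (fun a b => R a b ∧ ¬ (a = v ∧ b = u)) v u :=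
    fun h => h2 (reachable_remove hsc h)
  have hdisj : ∀ x, Relation.ReflTransGen (fun a b => R a b ∧ ¬ (a = u ∧ b = v)) u x →
      Relation.ReflTransGen (fun a b => R a b ∧ ¬ (a = v ∧ b = u)) v x → False := by
    intro x hx1 hx2
    have : ∀ y, Relation.ReflTransGen R x y →
        Relation.ReflTransGen (fun a b => R a b ∧ ¬ (a = u ∧ b = v)) u y ∧
        Relation.ReflTransGen (fun a b => R a b ∧ ¬ (a = v ∧ b = u)) v y := by
      intro y hy
      induction hy with
      | refl => exact ⟨hx1, hx2⟩
      | @tail c d _ hcd ih =>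
        have hcu : c ≠ u := fun h => hB (h ▸ ih.2)
        have hcv : c ≠ v := fun h => hA (h ▸ ih.1)
        exact ⟨ih.1.tail ⟨hcd, fun h => hcu h.1⟩, ih.2.tail ⟨hcd, fun h => hcv h.1⟩⟩
    exact hB (this u (hsc x u)).2
  have hu : ∀ x, x ≠ u → x ≠ v →
      ¬ Relation.ReflTransGen (fun a b => R a b ∧ ¬ (a = u ∧ b = v)) u x := by
    intro x hxu hxv hx
    rcases hc x v hxv with h | h
    · exact hA (hx.tail ⟨h, fun h => hxu h.1⟩)
    · exact hdisj x hx (.single ⟨h, fun h => hxu h.2⟩)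
  have hv : ∀ x, x ≠ u → x ≠ v →
      ¬ Relation.ReflTransGen (fun a b => R a b ∧ ¬ (a = v ∧ b = u)) v x := by
    intro x hxu hxv hx
    rcases hc x u hxu with h | h
    · exact hB (hx.tail ⟨h, fun h => hxv h.1⟩)
    · exact hdisj x (.single ⟨h, fun h => hxv h.2⟩) hx
  have : ∀ y, Relation.ReflTransGen R u y → y = u ∨ y = v := by
    intro y hy
    induction hy with
    | refl => exact .inl rfl
    | @tail c d _ hcd ih =>
      by_contra! hd
      rcases ih with rfl | rfl
      · exact hu d hd.1 hd.2 (.single ⟨hcd, fun h => hd.2 h.2⟩)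
      · exact hv d hd.1 hd.2 (.single ⟨hcd, fun h => hd.1 h.2⟩)
  rcases this w (hsc u w) with h | h
  · exact hwu h
  · exact hwv h

/-- A strongly connected complete digraph that is a tournament unless it has two vertices. -/
structure MinimalDigraph {n : ℕ} (R : Fin n → Fin n → Prop) : Prop where
  irrefl : ∀ u, ¬ R u u
  complete : ∀ u v, u ≠ v → R u v ∨ R v u
  reachable : ∀ u v, Relation.ReflTransGen R u v
  asymm : n ≠ 2 → ∀ u v, R u v → ¬ R v u

theorem exists_minimalDigraph_le {n : ℕ} {R : Fin n → Fin n → Prop} (hi : ∀ u, ¬ R u u)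
    (hc : ∀ u v, u ≠ v → R u v ∨ R v u) (hsc : ∀ u v, Relation.ReflTransGen R u v) :
    ∃ T, MinimalDigraph T ∧ ∀ u v, T u v → R u v := by
  obtain ⟨T, hTR, ⟨hTc, hTs⟩, hmin⟩ := exists_minimal_le_of_wellFoundedLT
    (fun T : Fin n → Fin n → Prop => (∀ u v, u ≠ v → T u v ∨ T v u) ∧
      ∀ u v, Relation.ReflTransGen T u v) R ⟨hc, hsc⟩
  refine ⟨T, ⟨fun u h => hi u (hTR u u h), hTc, hTs, fun hn u v huv hvu => ?_⟩, hTR⟩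
  have hne : u ≠ v := fun h => hi u (hTR u u (h ▸ huv))
  have hw : ∃ w, w ≠ u ∧ w ≠ v := by
    have h2 : ({u, v} : Finset (Fin n)).card < (Finset.univ : Finset (Fin n)).card := by
      rw [Finset.card_pair hne, Finset.card_univ, Fintype.card_fin]
      have := u.2; have := v.2
      have : u.1 ≠ v.1 := fun h => hne (Fin.ext h)
      omega
    obtain ⟨w, -, hw⟩ := Finset.exists_mem_notMem_of_card_lt_card h2
    exact ⟨w, by simpa using hw⟩
  obtain ⟨w, hwu, hwv⟩ := hw
  rcases remove_edge_or hTc hTs hwu hwv with h | h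
  · refine (hmin (y := fun a b => T a b ∧ ¬ (a = u ∧ b = v)) ⟨fun a b hab => ?_, h⟩
      (fun a b h => h.1) u v huv).2 ⟨rfl, rfl⟩
    have := hTc a b hab
    grind
  · refine (hmin (y := fun a b => T a b ∧ ¬ (a = v ∧ b = u)) ⟨fun a b hab => ?_, h⟩
      (fun a b h => h.1) v u hvu).2 ⟨rfl, rfl⟩
    have := hTc a b hab
    grind

theorem ncard_tournament {n : ℕ} {R : Fin n → Fin n → Prop} (hi : ∀ u, ¬ R u u)
    (hc : ∀ u v, u ≠ v → R u v ∨ R v u) (ha : ∀ u v, R u v → ¬ R v u) :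
    {p : Fin n × Fin n | R p.1 p.2}.ncard = n.choose 2 := by
  have h1 : {p : Fin n × Fin n | R p.1 p.2} ∪ Prod.swap '' {p : Fin n × Fin n | R p.1 p.2} =
      ((Finset.univ : Finset (Fin n)).offDiag : Set (Fin n × Fin n)) := by
    rw [Set.image_swap_eq_preimage_swap]
    ext ⟨a, b⟩
    simp only [Set.mem_union, Set.mem_preimage, Set.mem_ofPred_eq, Prod.fst_swap, Prod.snd_swap,
      Finset.mem_coe, Finset.mem_offDiag, Finset.mem_univ, true_and]
    exact ⟨fun h hab => by subst hab; exact hi a (h.elim id id), hc a b⟩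
  have h2 : Disjoint {p : Fin n × Fin n | R p.1 p.2}
      (Prod.swap '' {p : Fin n × Fin n | R p.1 p.2}) := by
    rw [Set.disjoint_left]
    rintro ⟨a, b⟩ hab hba
    rw [Set.image_swap_eq_preimage_swap] at hba
    exact ha a b hab hba
  have h3 := congrArg Set.ncard h1
  rw [Set.ncard_union_eq h2, Set.ncard_image_of_injective _ Prod.swap_injective,
    Set.ncard_coe_finset, Finset.offDiag_card, Finset.card_univ, Fintype.card_fin] at h3
  have h4 : n * n - n = n * (n - 1) := by rw [Nat.mul_sub, mul_one]
  rw [Nat.choose_two_right]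
  omega

theorem iff_ne_of_reachable_two {R : Fin 2 → Fin 2 → Prop} (hi : ∀ u, ¬ R u u)
    (hsc : ∀ u v, Relation.ReflTransGen R u v) (u v : Fin 2) : R u v ↔ u ≠ v := by
  refine ⟨fun h huv => hi u (huv ▸ h), fun huv => ?_⟩
  rcases (hsc u v).cases_head with h | ⟨w, hw, -⟩
  · exact absurd h huv
  · have : w ≠ u := fun h => hi u (h ▸ hw)
    have : w = v := by omega
    exact this ▸ hw

theorem MinimalDigraph.ncard {n : ℕ} {R : Fin n → Fin n → Prop} (h : MinimalDigraph R) :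
    {p : Fin n × Fin n | R p.1 p.2}.ncard = if n = 2 then 2 else n.choose 2 := by
  split_ifs with hn
  · subst hn
    have : {p : Fin 2 × Fin 2 | R p.1 p.2} =
        ((Finset.univ : Finset (Fin 2)).offDiag : Set (Fin 2 × Fin 2)) := by
      ext p
      rw [Set.mem_ofPred_eq, iff_ne_of_reachable_two h.irrefl h.reachable]
      simp
    rw [this, Set.ncard_coe_finset]
    rfl
  · exact ncard_tournament h.irrefl h.complete (h.asymm hn)

theorem card_minimalDigraph (n : ℕ) :
    Nat.card {R : Fin n → Fin n → Prop // MinimalDigraph R} =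
      if n = 2 then 1 else scTournaments n := by
  split_ifs with hn
  · subst hn
    rw [Nat.card_eq_one_iff_unique]
    refine ⟨⟨fun R S => Subtype.ext ?_⟩, ⟨⟨fun u v => u ≠ v, fun u h => h rfl, fun u v h => .inl h,
      fun u v => ?_, fun h => absurd rfl h⟩⟩⟩
    · funext u v
      rw [iff_ne_of_reachable_two R.2.irrefl R.2.reachable,
        iff_ne_of_reachable_two S.2.irrefl S.2.reachable]
    · by_cases h : u = v
      · exact h ▸ .refl
      · exact .single h
  · refine Nat.card_congr (Equiv.subtypeEquivRight fun R => ⟨fun h => ⟨h.irrefl, fun u v huv =>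
      ⟨h.asymm hn u v, (h.complete u v huv).resolve_right⟩, h.reachable⟩, fun h => ⟨h.1,
      fun u v huv => ?_, h.2.2, fun _ u v huv => ?_⟩⟩)
    · by_cases h' : R v u
      · exact .inr h'
      · exact .inl ((h.2.1 u v huv).2 h')
    · exact (h.2.1 u v fun h' => h.1 u (h' ▸ huv)).1 huv

theorem collapse_inj {α : Type*} [DecidableEq α] {x y x' y' : α} (h : x ≠ y)
    (he : collapse x y = collapse x' y') : x = x' ∧ y = y' := by
  have h1 := congrFun he x
  rw [collapse_apply, collapse_apply, if_pos rfl] at h1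
  split_ifs at h1 with h2
  · exact ⟨h2, h1⟩
  · exact absurd h1.symm h

theorem slide_inj {m n : ℕ} {i j i' j' : Fin m} {π π' : Equiv.Perm (Fin n)} (x : Fin n)
    (hij : i ≠ j) (h : slide i j π = slide i' j' π') : i = i' ∧ j = j' ∧ π = π' := by
  have h1 : ∀ y, (j, π y) = if i = i' then (j', π' y) else (i, y) := fun y => by
    have := congrFun h (i, y)
    rwa [slide_apply, slide_apply, if_pos rfl] at this
  by_cases hi : i = i'
  · simp only [if_pos hi, Prod.mk.injEq] at h1
    exact ⟨hi, (h1 x).1, Equiv.ext fun y => (h1 y).2⟩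
  · have := h1 x
    rw [if_neg hi] at this
    exact absurd (congrArg Prod.fst this).symm hij

theorem slide_ne_collapse {m n : ℕ} (hn : 2 ≤ n) {i j : Fin m} (hij : i ≠ j)
    (π : Equiv.Perm (Fin n)) (a b : Fin m × Fin n) : slide i j π ≠ collapse a b := by
  intro h
  have h1 : ∀ y, (i, y) = a := fun y => by
    by_contra hy
    have := congrFun h (i, y)
    rw [slide_apply, collapse_apply, if_pos rfl, if_neg hy] at this
    exact hij (congrArg Prod.fst this).symm
  have := (h1 ⟨0, by omega⟩).trans (h1 ⟨1, by omega⟩).symm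
  simp at this

/-- The pairs `i < j` of elements of `Fin m`. -/
abbrev OrderedPair (m : ℕ) : Type := {p : Fin m × Fin m // p.1 < p.2}

theorem card_orderedPair (m : ℕ) : Nat.card (OrderedPair m) = m.choose 2 := by
  rw [← ncard_tournament (R := fun u v : Fin m => u < v) (fun u => lt_irrefl u)
    (fun u v h => lt_or_gt_of_ne h) (fun u v h => h.asymm)]
  rfl

/-- For each pair `i < j` and each permutation `π`, choose `slide i j π` if `π` lies in the
prescribed set, and the slide `slide j i π⁻¹` in the opposite direction otherwise. -/
noncomputable def slideOf {m n : ℕ} (c : OrderedPair m → Set (Equiv.Perm (Fin n)))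
    (q : OrderedPair m × Equiv.Perm (Fin n)) : Function.End (Fin m × Fin n) :=
  open Classical in
  if q.2 ∈ c q.1 then slide q.1.1.1 q.1.1.2 q.2 else slide q.1.1.2 q.1.1.1 q.2⁻¹

theorem slideOf_injective {m n : ℕ} (hn : 2 ≤ n) (c : OrderedPair m → Set (Equiv.Perm (Fin n))) :
    Function.Injective (slideOf c) := by
  rintro ⟨⟨⟨i, j⟩, hij⟩, π⟩ ⟨⟨⟨i', j'⟩, hij'⟩, π'⟩ h
  unfold slideOf at h
  dsimp only at h hij hij'
  have x : Fin n := ⟨0, by omega⟩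
  split_ifs at h
  · obtain ⟨rfl, rfl, rfl⟩ := slide_inj x hij.ne h
    rfl
  · obtain ⟨rfl, rfl, -⟩ := slide_inj x hij.ne h
    exact absurd hij hij'.asymm
  · obtain ⟨rfl, rfl, -⟩ := slide_inj x hij.ne' h
    exact absurd hij hij'.asymm
  · obtain ⟨rfl, rfl, hπ⟩ := slide_inj x hij.ne' h
    rw [inv_inj.1 hπ]

theorem slideOf_eq_slide_iff {m n : ℕ} (hn : 2 ≤ n) (c : OrderedPair m → Set (Equiv.Perm (Fin n)))
    (q : OrderedPair m × Equiv.Perm (Fin n)) {i j : Fin m} (π : Equiv.Perm (Fin n)) (hij : i < j) :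
    slideOf c q = slide i j π ↔ q = (⟨(i, j), hij⟩, π) ∧ π ∈ c ⟨(i, j), hij⟩ := by
  obtain ⟨⟨⟨i', j'⟩, hij'⟩, π'⟩ := q
  have x : Fin n := ⟨0, by omega⟩
  dsimp only at hij'
  constructor
  · intro h
    unfold slideOf at h
    dsimp only at h
    split_ifs at h with hc
    · obtain ⟨rfl, rfl, rfl⟩ := slide_inj x hij'.ne h
      exact ⟨rfl, hc⟩
    · obtain ⟨rfl, rfl, -⟩ := slide_inj x hij'.ne' h
      exact absurd hij hij'.asymm
  · rintro ⟨h, hc⟩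
    rw [h]
    exact if_pos hc

theorem slideOf_eq_slide_inv_iff {m n : ℕ} (hn : 2 ≤ n)
    (c : OrderedPair m → Set (Equiv.Perm (Fin n)))
    (q : OrderedPair m × Equiv.Perm (Fin n)) {i j : Fin m} (π : Equiv.Perm (Fin n)) (hij : i < j) :
    slideOf c q = slide j i π⁻¹ ↔ q = (⟨(i, j), hij⟩, π) ∧ π ∉ c ⟨(i, j), hij⟩ := by
  obtain ⟨⟨⟨i', j'⟩, hij'⟩, π'⟩ := q
  have x : Fin n := ⟨0, by omega⟩
  dsimp only at hij'
  constructor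
  · intro h
    unfold slideOf at h
    dsimp only at h
    split_ifs at h with hc
    · obtain ⟨rfl, rfl, -⟩ := slide_inj x hij'.ne h
      exact absurd hij hij'.asymm
    · obtain ⟨rfl, rfl, hπ⟩ := slide_inj x hij'.ne' h
      obtain rfl := inv_inj.1 hπ
      exact ⟨rfl, hc⟩
  · rintro ⟨h, hc⟩
    rw [h]
    exact if_neg hc

theorem exists_slideOf_eq {m n : ℕ} (c : OrderedPair m → Set (Equiv.Perm (Fin n)))
    (q : OrderedPair m × Equiv.Perm (Fin n)) : ∃ i j π, i ≠ j ∧ slideOf c q = slide i j π := by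
  unfold slideOf
  split_ifs
  · exact ⟨_, _, _, q.1.2.ne, rfl⟩
  · exact ⟨_, _, _, q.1.2.ne', rfl⟩

/-- The idempotents determined by a digraph on each block and, for each pair `i < j`, the set of
permutations along which block `i` slides onto block `j`. -/
def stdSet {m n : ℕ} (T : Fin m → Fin n → Fin n → Prop)
    (c : OrderedPair m → Set (Equiv.Perm (Fin n))) : Set (Function.End (Fin m × Fin n)) :=
  Set.range (fun q : Σ i, {p : Fin n × Fin n | T i p.1 p.2} =>
    collapse (q.1, q.2.1.1) (q.1, q.2.1.2)) ∪ Set.range (slideOf c)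

section stdSet

variable {m n : ℕ} {T : Fin m → Fin n → Fin n → Prop}
  {c : OrderedPair m → Set (Equiv.Perm (Fin n))}

theorem collapse_mem_stdSet (hn : 2 ≤ n) {i : Fin m} {x y : Fin n} (hxy : x ≠ y) :
    collapse (i, x) (i, y) ∈ stdSet T c ↔ T i x y := by
  constructor
  · rintro (⟨⟨i', ⟨⟨x', y'⟩, h'⟩⟩, h⟩ | ⟨q, h⟩)
    · have hne : (i, x) ≠ (i, y) := fun h => hxy (Prod.ext_iff.1 h).2
      obtain ⟨h1, h2⟩ := collapse_inj hne h.symm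
      simp only [Prod.mk.injEq] at h1 h2
      obtain ⟨rfl, rfl⟩ := h1
      obtain ⟨-, rfl⟩ := h2
      exact h'
    · obtain ⟨i', j', π, hij, he⟩ := exists_slideOf_eq c q
      exact absurd (he.symm.trans h) (slide_ne_collapse hn hij π _ _)
  · exact fun h => .inl ⟨⟨i, ⟨(x, y), h⟩⟩, rfl⟩

theorem slide_mem_stdSet (hn : 2 ≤ n) {i j : Fin m} (hij : i < j) (π : Equiv.Perm (Fin n)) :
    slide i j π ∈ stdSet T c ↔ π ∈ c ⟨(i, j), hij⟩ := by
  constructor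
  · rintro (⟨_, h⟩ | ⟨q, h⟩)
    · exact absurd h.symm (slide_ne_collapse hn hij.ne π _ _)
    · exact ((slideOf_eq_slide_iff hn c q π hij).1 h).2
  · exact fun h => .inr ⟨_, (slideOf_eq_slide_iff hn c _ π hij).2 ⟨rfl, h⟩⟩

theorem slide_inv_mem_stdSet (hn : 2 ≤ n) {i j : Fin m} (hij : i < j) (π : Equiv.Perm (Fin n)) :
    slide j i π⁻¹ ∈ stdSet T c ↔ π ∉ c ⟨(i, j), hij⟩ := by
  constructor
  · rintro (⟨_, h⟩ | ⟨q, h⟩)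
    · exact absurd h.symm (slide_ne_collapse hn hij.ne' _ _ _)
    · exact ((slideOf_eq_slide_inv_iff hn c q π hij).1 h).2
  · exact fun h => .inr ⟨_, (slideOf_eq_slide_inv_iff hn c _ π hij).2 ⟨rfl, h⟩⟩

theorem stdSet_subset {U : Set (Function.End (Fin m × Fin n))}
    (h1 : ∀ i x y, T i x y → collapse (i, x) (i, y) ∈ U)
    (h2 : ∀ p π, π ∈ c p → slide p.1.1 p.1.2 π ∈ U)
    (h3 : ∀ p π, π ∉ c p → slide p.1.2 p.1.1 π⁻¹ ∈ U) : stdSet T c ⊆ U := by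
  rintro f (⟨q, rfl⟩ | ⟨q, rfl⟩)
  · exact h1 _ _ _ q.2.2
  · unfold slideOf
    split_ifs with h
    · exact h2 _ _ h
    · exact h3 _ _ h

theorem ncard_stdSet (hn : 2 ≤ n) (hT : ∀ i, MinimalDigraph (T i)) :
    (stdSet T c).ncard =
      m * (if n = 2 then 2 else n.choose 2) + n.factorial * m.choose 2 := by
  have : Finite (Function.End (Fin m × Fin n)) :=
    inferInstanceAs (Finite (Fin m × Fin n → Fin m × Fin n))
  unfold stdSet
  rw [Set.ncard_union_eq]
  · congr 1
    · rw [Set.ncard_range_of_injective, Nat.card_sigma]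
      · simp only [Nat.card_coe_set_eq, (hT _).ncard, Finset.sum_const, Finset.card_univ,
          Fintype.card_fin, smul_eq_mul]
      · rintro ⟨i, ⟨⟨x, y⟩, hxy⟩⟩ ⟨i', ⟨⟨x', y'⟩, hxy'⟩⟩ h
        have hne : (i, x) ≠ (i, y) := fun h => by
          obtain rfl : x = y := (Prod.ext_iff.1 h).2
          exact (hT i).irrefl x hxy
        obtain ⟨h1, h2⟩ := collapse_inj hne h
        simp only [Prod.mk.injEq] at h1 h2
        obtain ⟨rfl, rfl⟩ := h1
        obtain ⟨-, rfl⟩ := h2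
        rfl
    · rw [Set.ncard_range_of_injective (slideOf_injective hn c), Nat.card_prod, card_orderedPair,
        Nat.card_perm, Nat.card_fin, mul_comm]
  · rw [Set.disjoint_left]
    rintro _ ⟨_, rfl⟩ ⟨q, h⟩
    obtain ⟨i', j', π, hij, he⟩ := exists_slideOf_eq c q
    exact absurd (he.symm.trans h) (slide_ne_collapse hn hij π _ _)

theorem idempotent_of_mem_stdSet {f : Function.End (Fin m × Fin n)} (h : f ∈ stdSet T c) :
    f * f = f := by
  rcases h with ⟨q, rfl⟩ | ⟨q, rfl⟩
  · exact collapse_mul_self _ _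
  · obtain ⟨i', j', π, hij, he⟩ := exists_slideOf_eq c q
    rw [he]
    exact slide_mul_self hij π

theorem bp_of_mem_stdSet {f : Function.End (Fin m × Fin n)} (h : f ∈ stdSet T c) : BP f := by
  rcases h with ⟨q, rfl⟩ | ⟨q, rfl⟩
  · exact bp_collapse _ _ _
  · obtain ⟨i', j', π, hij, he⟩ := exists_slideOf_eq c q
    rw [he]
    exact bp_slide _ _ _

end stdSet

/-- The digraph on blocks with an edge `a → b` whenever some permutation slides block `a` onto
block `b`. -/
def blockDigraph {m : ℕ} {A : Type*} (c : OrderedPair m → Set A) (a b : Fin m) : Prop :=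
  (∃ h : a < b, (c ⟨(a, b), h⟩).Nonempty) ∨ ∃ h : b < a, c ⟨(b, a), h⟩ ≠ Set.univ

theorem blockDigraph_iff_nonempty {m : ℕ} {A : Type*} (c : OrderedPair m → Set A) {a b : Fin m}
    (h : a < b) : blockDigraph c a b ↔ (c ⟨(a, b), h⟩).Nonempty :=
  ⟨fun h' => h'.elim (fun h' => h'.2) fun h' => absurd h h'.1.asymm, fun h' => .inl ⟨h, h'⟩⟩

theorem blockDigraph_iff_ne_univ {m : ℕ} {A : Type*} (c : OrderedPair m → Set A) {a b : Fin m}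
    (h : a < b) : blockDigraph c b a ↔ c ⟨(a, b), h⟩ ≠ Set.univ :=
  ⟨fun h' => h'.elim (fun h' => absurd h h'.1.asymm) fun h' => h'.2, fun h' => .inr ⟨h, h'⟩⟩

theorem blockDigraph_irrefl {m : ℕ} {A : Type*} (c : OrderedPair m → Set A) (a : Fin m) :
    ¬ blockDigraph c a a :=
  fun h => h.elim (fun h => lt_irrefl a h.1) fun h => lt_irrefl a h.1

theorem blockDigraph_complete {m : ℕ} {A : Type*} [Nonempty A] (c : OrderedPair m → Set A)
    (a b : Fin m) (hab : a ≠ b) : blockDigraph c a b ∨ blockDigraph c b a := by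
  wlog h : a < b generalizing a b
  · exact (this b a hab.symm (lt_of_le_of_ne (not_lt.1 h) hab.symm)).symm
  rw [blockDigraph_iff_nonempty c h, blockDigraph_iff_ne_univ c h]
  by_contra! h'
  rw [h'.1] at h'
  exact Set.empty_ne_univ h'.2

theorem exists_slide_mem_stdSet_iff {m n : ℕ} (hn : 2 ≤ n) {T : Fin m → Fin n → Fin n → Prop}
    {c : OrderedPair m → Set (Equiv.Perm (Fin n))} (i j : Fin m) :
    (i ≠ j ∧ ∃ π, slide i j π ∈ stdSet T c) ↔ blockDigraph c i j := by
  rcases lt_trichotomy i j with h | rfl | h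
  · simp only [blockDigraph_iff_nonempty c h, slide_mem_stdSet hn h]
    exact ⟨fun h' => h'.2, fun h' => ⟨h.ne, h'⟩⟩
  · simp [blockDigraph_irrefl]
  · rw [blockDigraph_iff_ne_univ c h, Set.ne_univ_iff_exists_notMem]
    constructor
    · rintro ⟨-, π, hπ⟩
      exact ⟨π⁻¹, (slide_inv_mem_stdSet hn h π⁻¹).1 (by rwa [inv_inv])⟩
    · rintro ⟨π, hπ⟩
      exact ⟨h.ne', π⁻¹, (slide_inv_mem_stdSet hn h π).2 hπ⟩

theorem generates_stdSet {m n : ℕ} (hn : 2 ≤ n) {T : Fin m → Fin n → Fin n → Prop}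
    {c : OrderedPair m → Set (Equiv.Perm (Fin n))} (hT : ∀ i, MinimalDigraph (T i))
    (hc : ∀ i j, Relation.ReflTransGen (blockDigraph c) i j) : Generates (stdSet T c) where
  bp _ h := bp_of_mem_stdSet h
  collapse_or i x y hxy := by
    rw [collapse_mem_stdSet hn hxy, collapse_mem_stdSet hn hxy.symm]
    exact (hT i).complete x y hxy
  collapse_reachable i x y := by
    refine Relation.ReflTransGen.mono ?_ _ _ ((hT i).reachable x y)
    intro x y h
    have hxy : x ≠ y := fun h' => (hT i).irrefl y (h' ▸ h)
    exact ⟨hxy, (collapse_mem_stdSet hn hxy).2 h⟩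
  slide_or i j π hij := by
    rcases lt_or_gt_of_ne hij with h | h
    · rw [slide_mem_stdSet hn h, slide_inv_mem_stdSet hn h]
      exact em _
    · rw [slide_mem_stdSet hn h, ← inv_inv π, slide_inv_mem_stdSet hn h, inv_inv]
      exact (em _).symm
  slide_reachable i j := by
    simp only [exists_slide_mem_stdSet_iff hn]
    exact hc i j

theorem exists_subset_compl_subset {A : Type*} [Nontrivial A] {s t : Set A}
    (h : ∀ a, a ∈ s ∨ a ∈ t) :
    ∃ u ⊆ s, uᶜ ⊆ t ∧ (s.Nonempty → u.Nonempty) ∧ (t.Nonempty → u ≠ Set.univ) := by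
  rcases s.eq_empty_or_nonempty with rfl | ⟨a, ha⟩
  · exact ⟨∅, subset_rfl, fun a _ => (h a).resolve_left id, id, fun _ => Set.empty_ne_univ⟩
  rcases t.eq_empty_or_nonempty with rfl | ⟨b, hb⟩
  · exact ⟨Set.univ, fun a _ => (h a).resolve_right id, by simp, fun _ => Set.univ_nonempty,
      fun h => absurd h (by simp)⟩
  obtain ⟨a, b, ha, hb, hab⟩ : ∃ a b, a ∈ s ∧ b ∈ t ∧ a ≠ b := by
    obtain ⟨d, hd⟩ := exists_ne a
    by_cases hab : a = b
    · subst hab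
      rcases h d with h | h
      · exact ⟨d, a, h, hb, hd⟩
      · exact ⟨a, d, ha, h, hd.symm⟩
    · exact ⟨a, b, ha, hb, hab⟩
  refine ⟨s \ {b}, Set.sdiff_subset, fun d hd => ?_, fun _ => ⟨a, ha, hab⟩, fun _ hu => ?_⟩
  · by_cases hdb : d = b
    · exact hdb ▸ hb
    · exact (h d).resolve_left fun hs => hd ⟨hs, hdb⟩
  · have : b ∈ s \ {b} := hu ▸ Set.mem_univ b
    exact this.2 rfl

theorem Generates.exists_stdSet_subset {m n : ℕ} (hn : 2 ≤ n)
    {U : Set (Function.End (Fin m × Fin n))} (h : Generates U) :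
    ∃ (T : Fin m → Fin n → Fin n → Prop) (c : OrderedPair m → Set (Equiv.Perm (Fin n))),
      (∀ i, MinimalDigraph (T i)) ∧ (∀ i j, Relation.ReflTransGen (blockDigraph c) i j) ∧
      stdSet T c ⊆ U := by
  have : Nontrivial (Fin n) := Fin.nontrivial_iff_two_le.2 hn
  have hT : ∀ i, ∃ T, MinimalDigraph T ∧
      ∀ u v, T u v → u ≠ v ∧ collapse (i, u) (i, v) ∈ U := fun i =>
    exists_minimalDigraph_le (fun u h => h.1 rfl)
      (fun u v huv => (h.collapse_or i u v huv).imp (fun h => ⟨huv, h⟩) fun h => ⟨huv.symm, h⟩)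
      (h.collapse_reachable i)
  choose T hT hTU using hT
  have hc : ∀ p : OrderedPair m, ∃ u ⊆ {π | slide p.1.1 p.1.2 π ∈ U},
      uᶜ ⊆ {π | slide p.1.2 p.1.1 π⁻¹ ∈ U} ∧
      ({π | slide p.1.1 p.1.2 π ∈ U}.Nonempty → u.Nonempty) ∧
      ({π | slide p.1.2 p.1.1 π⁻¹ ∈ U}.Nonempty → u ≠ Set.univ) := fun p =>
    exists_subset_compl_subset fun π => h.slide_or p.1.1 p.1.2 π p.2.ne
  choose c hc1 hc2 hc3 hc4 using hc
  refine ⟨T, c, hT, fun i j => Relation.ReflTransGen.mono ?_ _ _ (h.slide_reachable i j),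
    stdSet_subset (fun i x y h => (hTU i x y h).2) (fun p π h => hc1 p h) fun p π h => hc2 p h⟩
  rintro i j ⟨hij, π, hπ⟩
  rcases lt_or_gt_of_ne hij with h | h
  · exact .inl ⟨h, hc3 ⟨(i, j), h⟩ ⟨π, hπ⟩⟩
  · exact .inr ⟨h, hc4 ⟨(j, i), h⟩ ⟨π⁻¹, by rwa [Set.mem_ofPred_eq, inv_inv]⟩⟩

theorem stdSet_injOn {m n : ℕ} (hn : 2 ≤ n) : Set.InjOn
    (fun q : (Fin m → Fin n → Fin n → Prop) × (OrderedPair m → Set (Equiv.Perm (Fin n))) =>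
      stdSet q.1 q.2)
    ({T | ∀ i, MinimalDigraph (T i)} ×ˢ
      {c | ∀ i j, Relation.ReflTransGen (blockDigraph c) i j}) := by
  rintro ⟨T, c⟩ ⟨hT, -⟩ ⟨T', c'⟩ ⟨hT', -⟩ h
  dsimp only at h hT hT'
  refine Prod.ext ?_ ?_
  · funext i x y
    by_cases hxy : x = y
    · subst hxy
      exact propext (iff_of_false ((hT i).irrefl x) ((hT' i).irrefl x))
    · dsimp only
      rw [← collapse_mem_stdSet (T := T) (c := c) hn hxy, h, collapse_mem_stdSet hn hxy]
  · funext p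
    ext π
    dsimp only
    rw [← slide_mem_stdSet (T := T) hn p.2, h, slide_mem_stdSet hn p.2]

theorem minimal_generating_sets_eq {m n : ℕ} (hn : 2 ≤ n) :
    {U : Set (Function.End (Fin m × Fin n)) | (∀ f ∈ U, f * f = f) ∧
        Submonoid.closure U
          = Submonoid.closure {f : Function.End (Fin m × Fin n) | BP f ∧ f * f = f} ∧
        U.ncard = m * (if n = 2 then 2 else n.choose 2) + n.factorial * m.choose 2} =
    (fun q : (Fin m → Fin n → Fin n → Prop) × (OrderedPair m → Set (Equiv.Perm (Fin n))) =>
      stdSet q.1 q.2) '' ({T | ∀ i, MinimalDigraph (T i)} ×ˢ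
      {c | ∀ i j, Relation.ReflTransGen (blockDigraph c) i j}) := by
  have : Finite (Function.End (Fin m × Fin n)) :=
    inferInstanceAs (Finite (Fin m × Fin n → Fin m × Fin n))
  ext U
  constructor
  · rintro ⟨hU, hcl, hcard⟩
    obtain ⟨T, c, hT, hc, hsub⟩ := ((closure_eq_iff hn hU).1 hcl).exists_stdSet_subset hn
    exact ⟨(T, c), ⟨hT, hc⟩, Set.eq_of_subset_of_ncard_le hsub
      (by rw [hcard, ncard_stdSet hn hT]) (Set.toFinite U)⟩
  · rintro ⟨⟨T, c⟩, ⟨hT, hc⟩, rfl⟩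
    have hi : ∀ f ∈ stdSet T c, f * f = f := fun f => idempotent_of_mem_stdSet
    exact ⟨hi, (closure_eq_iff hn hi).2 (generates_stdSet hn hT hc), ncard_stdSet hn hT⟩

theorem ncard_forall_mem {ι β : Type*} [Fintype ι] (s : ι → Set β) :
    {f : ι → β | ∀ i, f i ∈ s i}.ncard = ∏ i, (s i).ncard :=
  (Nat.card_congr (Equiv.subtypePiEquivPi (p := fun i b => b ∈ s i))).trans Nat.card_pi

theorem ncard_forall_minimalDigraph (m n : ℕ) :
    {T : Fin m → Fin n → Fin n → Prop | ∀ i, MinimalDigraph (T i)}.ncard =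
      (if n = 2 then 1 else scTournaments n) ^ m := by
  refine (ncard_forall_mem fun _ : Fin m => {R | MinimalDigraph R}).trans ?_
  rw [Finset.prod_const, Finset.card_univ, Fintype.card_fin, ← card_minimalDigraph]
  rfl

theorem ncard_nonempty_and_ne_univ {A : Type*} [Fintype A] [Nonempty A] :
    {s : Set A | s.Nonempty ∧ s ≠ Set.univ}.ncard = 2 ^ Fintype.card A - 2 := by
  have h : {s : Set A | s.Nonempty ∧ s ≠ Set.univ} = {∅, Set.univ}ᶜ := by
    ext s
    simp [Set.nonempty_iff_ne_empty]
  rw [h, Set.ncard_compl, Set.ncard_pair Set.empty_ne_univ, Nat.card_eq_fintype_card,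
    Fintype.card_set]

theorem ncard_nonempty_iff_and_ne_univ_iff {A : Type*} [Fintype A] [Nonempty A] {P Q : Prop}
    [Decidable (P ∧ Q)] (h : P ∨ Q) :
    {s : Set A | (s.Nonempty ↔ P) ∧ (s ≠ Set.univ ↔ Q)}.ncard =
      if P ∧ Q then 2 ^ Fintype.card A - 2 else 1 := by
  split_ifs with hPQ
  · simp only [iff_true_intro hPQ.1, iff_true_intro hPQ.2, iff_true, ncard_nonempty_and_ne_univ]
  · rw [Set.ncard_eq_one]
    by_cases hP : P
    · have hQ : ¬ Q := fun hQ => hPQ ⟨hP, hQ⟩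
      refine ⟨Set.univ, ?_⟩
      ext s
      simp only [hP, hQ, iff_true, iff_false, not_not, Set.mem_ofPred_eq, Set.mem_singleton_iff]
      exact ⟨fun h => h.2, fun h => ⟨h ▸ Set.univ_nonempty, h⟩⟩
    · have hQ : Q := h.resolve_left hP
      refine ⟨∅, ?_⟩
      ext s
      simp only [hP, hQ, iff_true, iff_false, Set.not_nonempty_iff_eq_empty, Set.mem_ofPred_eq,
        Set.mem_singleton_iff]
      exact ⟨fun h => h.1, fun h => ⟨h, h ▸ Set.empty_ne_univ⟩⟩

theorem ncard_blockDigraph_eq {m : ℕ} {A : Type*} [Fintype A] [Nonempty A]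
    {R : Fin m → Fin m → Prop} (hi : ∀ u, ¬ R u u) (hc : ∀ u v, u ≠ v → R u v ∨ R v u) :
    {c : OrderedPair m → Set A | blockDigraph c = R}.ncard =
      (2 ^ Fintype.card A - 2) ^
        {p : Fin m × Fin m | p.1 < p.2 ∧ R p.1 p.2 ∧ R p.2 p.1}.ncard := by
  classical
  have h1 : {c : OrderedPair m → Set A | blockDigraph c = R} =
      {c | ∀ p, c p ∈ {s : Set A | (s.Nonempty ↔ R p.1.1 p.1.2) ∧
        (s ≠ Set.univ ↔ R p.1.2 p.1.1)}} := by
    ext c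
    constructor
    · rintro rfl p
      exact ⟨(blockDigraph_iff_nonempty c p.2).symm, (blockDigraph_iff_ne_univ c p.2).symm⟩
    · intro h
      funext a b
      rcases lt_trichotomy a b with hab | rfl | hab
      · rw [blockDigraph_iff_nonempty c hab, (h ⟨(a, b), hab⟩).1]
      · exact propext (iff_of_false (blockDigraph_irrefl c a) (hi a))
      · rw [blockDigraph_iff_ne_univ c hab, (h ⟨(b, a), hab⟩).2]
  have h2 : {p : Fin m × Fin m | p.1 < p.2 ∧ R p.1 p.2 ∧ R p.2 p.1}.ncard =
      (Finset.univ.filter fun p : OrderedPair m => R p.1.1 p.1.2 ∧ R p.1.2 p.1.1).card := by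
    rw [← Set.ncard_coe_finset, ← Set.ncard_image_of_injective _ Subtype.val_injective]
    congr 1
    ext p
    simp only [Set.mem_ofPred_eq, Finset.coe_filter, Finset.mem_univ, true_and, Set.mem_image,
      Subtype.exists, exists_and_left, exists_prop, exists_eq_right_right]
    exact and_comm
  rw [h1, ncard_forall_mem, h2, ← Finset.prod_const, Finset.prod_filter]
  refine Finset.prod_congr rfl fun p _ => ?_
  exact ncard_nonempty_iff_and_ne_univ_iff (hc _ _ p.2.ne)

theorem ncard_reachable_blockDigraph {m : ℕ} {A : Type*} [Fintype A] [Nonempty A] :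
    {c : OrderedPair m → Set A | ∀ i j, Relation.ReflTransGen (blockDigraph c) i j}.ncard =
      ∑ k ∈ Finset.range (m.choose 2 + 1), wdig m k * (2 ^ Fintype.card A - 2) ^ k := by
  classical
  let D : Finset (Fin m → Fin m → Prop) := Finset.univ.filter fun R => (∀ u, ¬ R u u) ∧
    (∀ u v, u ≠ v → R u v ∨ R v u) ∧ ∀ u v, Relation.ReflTransGen R u v
  let d : (Fin m → Fin m → Prop) → ℕ := fun R =>
    {p : Fin m × Fin m | p.1 < p.2 ∧ R p.1 p.2 ∧ R p.2 p.1}.ncard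
  have hd : ∀ R ∈ D, d R ∈ Finset.range (m.choose 2 + 1) := fun R _ => by
    rw [Finset.mem_range, Nat.lt_succ_iff, ← card_orderedPair]
    exact Set.ncard_le_ncard fun p hp => hp.1
  have hD : ∀ c ∈ (Finset.univ.filter fun c : OrderedPair m → Set A =>
      ∀ i j, Relation.ReflTransGen (blockDigraph c) i j), blockDigraph c ∈ D := fun c hc => by
    rw [Finset.mem_filter] at hc ⊢
    exact ⟨Finset.mem_univ _, blockDigraph_irrefl c, blockDigraph_complete c, hc.2⟩
  calc _ = (Finset.univ.filter fun c : OrderedPair m → Set A =>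
        ∀ i j, Relation.ReflTransGen (blockDigraph c) i j).card := by
        rw [← Set.ncard_coe_finset, Finset.coe_filter_univ]
    _ = ∑ R ∈ D, (2 ^ Fintype.card A - 2) ^ d R := by
        rw [Finset.card_eq_sum_card_fiberwise hD]
        refine Finset.sum_congr rfl fun R hR => ?_
        obtain ⟨-, hi, hc, hr⟩ := Finset.mem_filter.1 hR
        rw [← ncard_blockDigraph_eq hi hc, ← Set.ncard_coe_finset]
        congr 1
        ext c
        simp only [Finset.coe_filter, Finset.mem_filter, Finset.mem_univ, true_and,
          Set.mem_ofPred_eq, and_iff_right_iff_imp]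
        rintro rfl
        exact hr
    _ = ∑ k ∈ Finset.range (m.choose 2 + 1), ∑ R ∈ D with d R = k,
          (2 ^ Fintype.card A - 2) ^ d R := (Finset.sum_fiberwise_of_maps_to hd _).symm
    _ = _ := by
        refine Finset.sum_congr rfl fun k _ => ?_
        rw [Finset.sum_congr rfl (g := fun _ => (2 ^ Fintype.card A - 2) ^ k)
          fun R hR => by rw [(Finset.mem_filter.1 hR).2], Finset.sum_const, smul_eq_mul]
        congr 1
        rw [wdig, ← Set.ncard_coe_finset]
        refine (Nat.card_coe_set_eq _).symm.trans (congrArg (fun s : Set _ => Nat.card s) ?_)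
        ext R
        simp only [D, d, Finset.coe_filter, Finset.mem_filter, Finset.mem_univ, true_and,
          Set.mem_ofPred_eq, and_assoc]
        rfl

/-- Let `m, n ≥ 2` and let `S = E(X,P)` be the idempotent-generated
submonoid of `T(X,P)`.  Then (a) every idempotent generating set of `S` contains an
idempotent generating set of the minimal cardinality `m·ρ_n + n!·(m choose 2)` (where
`ρ_2 = 2` and `ρ_n = (n choose 2)` for `n ≥ 3`), and (b) the number of idempotent
generating sets of `S` of minimal cardinality equals
`σ_n^m · ∑_{k=0}^{(m choose 2)} w_{mk}·(2^{n!} − 2)^k`, where `σ_2 = 1`, `σ_n` is the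
number of strongly connected tournaments on `n` vertices for `n ≠ 2`, and `w_{mk}` is the
number of strongly connected complete digraphs on `m` vertices with `k` double edges. -/
theorem stmt_19 (m n : ℕ) (hm : 2 ≤ m) (hn : 2 ≤ n) :
    (∀ U : Set (Function.End (Fin m × Fin n)),
      (∀ f ∈ U, f * f = f) →
      Submonoid.closure U
        = Submonoid.closure {f : Function.End (Fin m × Fin n) | BP f ∧ f * f = f} →
      ∃ V ⊆ U,
        V.ncard = m * (if n = 2 then 2 else n.choose 2) + n.factorial * m.choose 2 ∧
        Submonoid.closure V
          = Submonoid.closure {f : Function.End (Fin m × Fin n) | BP f ∧ f * f = f}) ∧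
    {U : Set (Function.End (Fin m × Fin n)) |
        (∀ f ∈ U, f * f = f) ∧
        Submonoid.closure U
          = Submonoid.closure {f : Function.End (Fin m × Fin n) | BP f ∧ f * f = f} ∧
        U.ncard = m * (if n = 2 then 2 else n.choose 2) + n.factorial * m.choose 2}.ncard
      = (if n = 2 then 1 else scTournaments n) ^ m *
          ∑ k ∈ Finset.range (m.choose 2 + 1), wdig m k * (2 ^ n.factorial - 2) ^ k := by
  have hV := @closure_eq_iff m n hn
  refine ⟨fun U hU hcl => ?_, ?_⟩
  · obtain ⟨T, c, hT, hc, hsub⟩ := ((hV hU).1 hcl).exists_stdSet_subset hn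
    exact ⟨_, hsub, ncard_stdSet hn hT, (hV fun f hf => hU f (hsub hf)).2
      (generates_stdSet hn hT hc)⟩
  · rw [minimal_generating_sets_eq hn, (stdSet_injOn hn).ncard_image, Set.ncard_prod,
      ncard_forall_minimalDigraph, ncard_reachable_blockDigraph, Fintype.card_perm, Fintype.card_fin]
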